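/- arXiv:cs/0609166 — 2 statements merged into one kernel-verified Lean document; each statement's English description precedes it below -/
import Mathlib

section
/- Let ε > 0 and let S ⊆ {0,…,N−1} be any set of indices containing the qualified index set Q_{c,B,ε/(B(1+ε))}. Then the restriction c·1_S satisfies ‖c·1_S − c‖₂² ≤ (1+ε)·‖c_opt − c‖₂². -/
/-- The tail sum `∑_{i=j}^{N-1} c_i²`. -/
noncomputable def tailSum (N : ℕ) (c : Fin N → ℝ) (j : ℕ) : ℝ :=
  ∑ i ∈ Finset.univ.filter (fun i : Fin N => j ≤ (i : ℕ)), c i ^ 2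

/-- The qualified length `m(c,ℓ,θ)`: the least `j < ℓ` with
`c_j² < θ·∑_{i=j}^{N-1} c_i²`, or `ℓ` if no such `j` exists. -/
noncomputable def qualLen (N : ℕ) (c : Fin N → ℝ) (ℓ : ℕ) (θ : ℝ) : ℕ :=
  sInf ({j : ℕ | ∃ hj : j < N, j < ℓ ∧ c ⟨j, hj⟩ ^ 2 < θ * tailSum N c j} ∪ {ℓ})

theorem sum_sq_restrict_sub (N : ℕ) (c : Fin N → ℝ) (p : Fin N → Prop) [DecidablePred p] :
    ∑ i : Fin N, ((if p i then c i else 0) - c i) ^ 2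
      = ∑ i ∈ Finset.univ.filter (fun i => ¬ p i), c i ^ 2 := by
  rw [Finset.sum_filter]
  refine Finset.sum_congr rfl fun i _ => ?_
  by_cases h : p i <;> simp [h]

/-- For entries sorted by magnitude, each of the at most `B` entries with index in `[j, B)`
contributes at most `c_j²` to the tail sum from `j`. -/
theorem tailSum_le_mul_sq_add_tailSum (N B : ℕ) (c : Fin N → ℝ)
    (hsorted : ∀ i j : Fin N, i ≤ j → |c j| ≤ |c i|) (j : Fin N) :
    tailSum N c j ≤ B * c j ^ 2 + tailSum N c B := by
  have hhead : ∑ i ∈ Finset.univ.filter (fun i : Fin N => (i : ℕ) < B ∧ j ≤ i), c i ^ 2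
      ≤ B * c j ^ 2 := by
    have hcard : (Finset.univ.filter (fun i : Fin N => (i : ℕ) < B ∧ j ≤ i)).card ≤ B := by
      rw [← Finset.card_range B]
      refine Finset.card_le_card_of_injOn (fun i => (i : ℕ)) ?_ Fin.val_injective.injOn
      intro i hi
      simp_all
    refine (Finset.sum_le_card_nsmul _ _ (c j ^ 2) fun i hi => ?_).trans ?_
    · exact sq_le_sq.mpr (hsorted j i (Finset.mem_filter.mp hi).2.2)
    · rw [nsmul_eq_mul]
      gcongr
  refine le_trans ?_ (add_le_add_left hhead _)
  unfold tailSum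
  simp only [Finset.sum_filter, ← Finset.sum_add_distrib]
  refine Finset.sum_le_sum fun i _ => ?_
  have := sq_nonneg (c i)
  split_ifs <;> first | linarith | (exfalso; grind)

theorem tailSum_qualLen_le (N B : ℕ) (hB : 0 < B) (c : Fin N → ℝ)
    (hsorted : ∀ i j : Fin N, i ≤ j → |c j| ≤ |c i|) (ε : ℝ) (hε : 0 < ε) :
    tailSum N c (qualLen N c B (ε / (B * (1 + ε)))) ≤ (1 + ε) * tailSum N c B := by
  have hmem : qualLen N c B (ε / (B * (1 + ε))) ∈
      ({j : ℕ | ∃ hj : j < N, j < B ∧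
        c ⟨j, hj⟩ ^ 2 < ε / (B * (1 + ε)) * tailSum N c j} ∪ {B} : Set ℕ) :=
    Nat.sInf_mem ⟨B, Or.inr rfl⟩
  generalize qualLen N c B (ε / (B * (1 + ε))) = m at hmem ⊢
  rcases hmem with ⟨hm, -, hlt⟩ | rfl
  · have hle := tailSum_le_mul_sq_add_tailSum N B c hsorted ⟨m, hm⟩
    have hB' : (0 : ℝ) < B := by exact_mod_cast hB
    have hmul := mul_lt_mul_of_pos_left hlt (mul_pos hB' (by linarith : 0 < 1 + ε))
    have hcancel : B * (1 + ε) * (ε / (B * (1 + ε)) * tailSum N c m) = ε * tailSum N c m := by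
      field_simp
    rw [hcancel] at hmul
    have := mul_le_mul_of_nonneg_left hle (by linarith : 0 ≤ 1 + ε)
    simp only at this
    linarith
  · have : 0 ≤ tailSum N c m := Finset.sum_nonneg fun i _ => sq_nonneg _
    nlinarith

/-- Restricting `c` to any index set `S` containing the qualified index set
`Q_{c,B,ε/(B(1+ε))}` gives squared Euclidean error at most `(1+ε)` times that of
the best `B`-term approximation. -/
theorem superset_of_qualified_is_good (N B : ℕ) (hN : 0 < N) (hB : 0 < B) (hBN : B ≤ N)
    (c : Fin N → ℝ)
    (hsorted : ∀ i j : Fin N, i ≤ j → |c j| ≤ |c i|)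
    (ε : ℝ) (hε : 0 < ε)
    (S : Finset (Fin N))
    (hS : ∀ i : Fin N, (i : ℕ) < qualLen N c B (ε / (B * (1 + ε))) → i ∈ S) :
    ∑ i : Fin N, ((if i ∈ S then c i else 0) - c i) ^ 2
      ≤ (1 + ε) * ∑ i : Fin N, ((if (i : ℕ) < B then c i else 0) - c i) ^ 2 := by
  rw [sum_sq_restrict_sub N c (· ∈ S), sum_sq_restrict_sub N c fun i => (i : ℕ) < B]
  simp only [not_lt]
  refine le_trans ?_ (tailSum_qualLen_le N B hB c hsorted ε hε)
  refine Finset.sum_le_sum_of_subset_of_nonneg (fun i hi => ?_) fun i _ _ => sq_nonneg _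
  simp only [Finset.mem_filter, Finset.mem_univ, true_and] at hi ⊢
  exact not_lt.mp fun h => hi (hS i h)
end

section
/- Let ε > 0, set θ = ε/(B(1+ε)), and suppose s_0,…,s_{B−1} are real numbers satisfying (1/(1+ε))·Σ_{i=j}^{N−1} c_i² ≤ s_j ≤ Σ_{i=j}^{N−1} c_i² for each j < B. Let S = {0,…,m−1} be the longest prefix with m ≤ B such that c_j² ≥ θ·s_j for all j < m. Then ‖c·1_S − c‖₂² ≤ (1+ε)·‖c_opt − c‖₂². -/
/-- The output length of the protocol: the longest `m ≤ B` such that the test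
`c_j² ≥ θ·s_j` passes for all `j < m`. -/
noncomputable def outLen (N B : ℕ) (c : Fin N → ℝ) (θ : ℝ) (s : ℕ → ℝ) : ℕ :=
  sSup {m : ℕ | m ≤ B ∧ ∀ j : Fin N, (j : ℕ) < m → θ * s j ≤ c j ^ 2}

theorem sum_prefix_sub_sq_eq_tailSum (N : ℕ) (c : Fin N → ℝ) (k : ℕ) :
    ∑ i : Fin N, ((if (i : ℕ) < k then c i else 0) - c i) ^ 2 = tailSum N c k := by
  rw [tailSum, Finset.sum_filter]
  refine Finset.sum_congr rfl fun i _ => ?_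
  by_cases h : (i : ℕ) < k
  · simp [h]
  · simp [h, not_lt.mp h]

theorem tailSum_eq_add_tailSum_succ (N : ℕ) (c : Fin N → ℝ) (j : Fin N) :
    tailSum N c j = c j ^ 2 + tailSum N c (j + 1) := by
  have h : Finset.univ.filter (fun i : Fin N => (j : ℕ) ≤ i) =
      insert j (Finset.univ.filter fun i : Fin N => (j : ℕ) + 1 ≤ i) := by
    ext i
    simp only [Finset.mem_filter, Finset.mem_univ, true_and, Finset.mem_insert, Fin.ext_iff]
    omega
  rw [tailSum, h, Finset.sum_insert (by simp), tailSum]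

theorem tailSum_le_mul_add_tailSum (N : ℕ) (c : Fin N → ℝ) (m : ℕ) (a : ℝ)
    (ha : ∀ i : Fin N, m ≤ (i : ℕ) → c i ^ 2 ≤ a) (k : ℕ) (hmk : m ≤ k) (hk : k ≤ N) :
    tailSum N c m ≤ ((k : ℝ) - m) * a + tailSum N c k := by
  induction k, hmk using Nat.le_induction with
  | base => simp
  | succ k hmk ih =>
    have h₁ := ih (by omega)
    have h₂ := tailSum_eq_add_tailSum_succ N c ⟨k, hk⟩
    have h₃ := ha ⟨k, hk⟩ hmk
    simp only at h₂
    push_cast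
    linarith

/-- If the output prefix is shorter than `B`, the test fails at its end. -/
theorem outLen_eq_or_exists_fail (N B : ℕ) (hBN : B ≤ N) (c : Fin N → ℝ) (θ : ℝ) (s : ℕ → ℝ) :
    outLen N B c θ s = B ∨
      ∃ j : Fin N, (j : ℕ) = outLen N B c θ s ∧ (j : ℕ) < B ∧ c j ^ 2 < θ * s j := by
  have hbdd : BddAbove {m : ℕ | m ≤ B ∧ ∀ j : Fin N, (j : ℕ) < m → θ * s j ≤ c j ^ 2} :=
    ⟨B, fun m hm => hm.1⟩
  have hmem : outLen N B c θ s ∈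
      {m : ℕ | m ≤ B ∧ ∀ j : Fin N, (j : ℕ) < m → θ * s j ≤ c j ^ 2} :=
    Nat.sSup_mem ⟨0, Nat.zero_le B, by simp⟩ hbdd
  obtain ⟨hle, htest⟩ := hmem
  rcases hle.eq_or_lt with h | hlt
  · exact Or.inl h
  · refine Or.inr ⟨⟨_, hlt.trans_le hBN⟩, rfl, hlt, ?_⟩
    by_contra! hpass
    have hsucc : outLen N B c θ s + 1 ≤ outLen N B c θ s := by
      refine le_csSup hbdd ⟨hlt, fun j hj => ?_⟩
      rcases (Nat.lt_succ_iff.mp hj).eq_or_lt with h | h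
      · obtain rfl : j = ⟨_, hlt.trans_le hBN⟩ := Fin.ext h
        exact hpass
      · exact htest j h
    omega

/-- If each `s_j` is a `(1+ε)`-underestimate of the tail sum `∑_{i=j}^{N-1} c_i²`,
then restricting `c` to the output prefix (for threshold `θ = ε/(B(1+ε))`) gives
squared Euclidean error at most `(1+ε)` times that of the best `B`-term
approximation. -/
theorem output_is_good (N B : ℕ) (hN : 0 < N) (hB : 0 < B) (hBN : B ≤ N)
    (c : Fin N → ℝ)
    (hsorted : ∀ i j : Fin N, i ≤ j → |c j| ≤ |c i|)
    (ε : ℝ) (hε : 0 < ε) (s : ℕ → ℝ)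
    (hs : ∀ j : ℕ, j < B → tailSum N c j / (1 + ε) ≤ s j ∧ s j ≤ tailSum N c j) :
    ∑ i : Fin N,
        ((if (i : ℕ) < outLen N B c (ε / (B * (1 + ε))) s then c i else 0) - c i) ^ 2
      ≤ (1 + ε) * ∑ i : Fin N, ((if (i : ℕ) < B then c i else 0) - c i) ^ 2 := by
  rw [sum_prefix_sub_sq_eq_tailSum, sum_prefix_sub_sq_eq_tailSum]
  have hnonneg : ∀ k, 0 ≤ tailSum N c k := fun k => Finset.sum_nonneg fun i _ => sq_nonneg _
  rcases outLen_eq_or_exists_fail N B hBN c (ε / (B * (1 + ε))) s with h | ⟨j, hj, hjB, hfail⟩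
  · rw [h]
    nlinarith [hnonneg B]
  · rw [← hj]
    have hB' : (0 : ℝ) < B := Nat.cast_pos.mpr hB
    have hsum := tailSum_le_mul_add_tailSum N c j (c j ^ 2)
      (fun i hi => sq_le_sq.mpr (hsorted j i hi)) B hjB.le hBN
    have hsq : c j ^ 2 ≤ ε / (B * (1 + ε)) * tailSum N c j :=
      hfail.le.trans (mul_le_mul_of_nonneg_left (hs j hjB).2 (by positivity))
    have hmul : ((B : ℝ) - (j : ℕ)) * c j ^ 2 ≤ B * (ε / (B * (1 + ε)) * tailSum N c j) :=
      (mul_le_mul_of_nonneg_right (by simp) (sq_nonneg _)).trans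
        (mul_le_mul_of_nonneg_left hsq hB'.le)
    have hcancel : (1 + ε) * (B * (ε / (B * (1 + ε)) * tailSum N c j)) = ε * tailSum N c j := by
      field_simp
    have hscaled := mul_le_mul_of_nonneg_left (hsum.trans (add_le_add_left hmul _))
      (by positivity : 0 ≤ 1 + ε)
    rw [mul_add, hcancel] at hscaled
    linarith
end
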